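/- For each p ∈ [2, ∞) there exists a Banach space X̃_p which is both uniformly convex and uniformly smooth such that the pair (X̃_p, ℓ_p²) fails the pointwise Bishop–Phelps–Bollobás property, where ℓ_p² denotes ℝ² equipped with the norm ‖(s, t)‖_p = (|s|^p + |t|^p)^{1/p}. -/

import Mathlib

open scoped Topology ENNReal
open Filter Metric

noncomputable section

/-- The pair `(X, Y)` has the pointwise Bishop–Phelps–Bollobás property. -/
def PtwiseBPB (𝕜 X Y : Type*) [RCLike 𝕜] [NormedAddCommGroup X] [NormedSpace 𝕜 X]
    [NormedAddCommGroup Y] [NormedSpace 𝕜 Y] : Prop :=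
  ∀ ε : ℝ, 0 < ε → ∃ η : ℝ, 0 < η ∧ ∀ (T : X →L[𝕜] Y) (x₀ : X),
    ‖T‖ = 1 → ‖x₀‖ = 1 → 1 - η < ‖T x₀‖ →
    ∃ S : X →L[𝕜] Y, ‖S‖ = 1 ∧ ‖S x₀‖ = 1 ∧ ‖S - T‖ < ε

/-- The modulus of the pointwise BPB property of the pair `(X, Y)`. -/
def bpbModulus (𝕜 X Y : Type*) [RCLike 𝕜] [NormedAddCommGroup X] [NormedSpace 𝕜 X]
    [NormedAddCommGroup Y] [NormedSpace 𝕜 Y] (ε : ℝ) : ℝ :=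
  sSup (insert 0 {ρ : ℝ | 0 < ρ ∧ ∀ (T : X →L[𝕜] Y) (x₀ : X),
    ‖T‖ = 1 → ‖x₀‖ = 1 → 1 - ρ < ‖T x₀‖ →
    ∃ S : X →L[𝕜] Y, ‖S‖ = 1 ∧ ‖S x₀‖ = 1 ∧ ‖S - T‖ < ε})

/-- The modulus of smoothness of a normed space. -/
def modulusOfSmoothness (X : Type*) [NormedAddCommGroup X] (t : ℝ) : ℝ :=
  sSup {r : ℝ | ∃ x y : X, ‖x‖ = 1 ∧ ‖y‖ ≤ t ∧ r = (‖x + y‖ + ‖x - y‖ - 2) / 2}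

/-- A normed space is uniformly smooth if `ρ_X(t)/t → 0` as `t → 0⁺`. -/
def UniformlySmooth (X : Type*) [NormedAddCommGroup X] : Prop :=
  Filter.Tendsto (fun t => modulusOfSmoothness X t / t) (𝓝[>] (0:ℝ)) (𝓝 0)

/-- The modulus of convexity of a normed space. -/
def modulusOfConvexity (X : Type*) [NormedAddCommGroup X] (ε : ℝ) : ℝ :=
  sInf {r : ℝ | ∃ x y : X, ‖x‖ ≤ 1 ∧ ‖y‖ ≤ 1 ∧ ε ≤ ‖x - y‖ ∧ r = 1 - ‖x + y‖ / 2}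


/-- An even function on a normed space lying between two quadratic functions in the strong sense:
it is strongly convex with constant `a` and strongly semiconcave with constant `b`. -/
structure QuadraticPotential (E : Type*) [NormedAddCommGroup E] [NormedSpace ℝ E] where
  toFun : E → ℝ
  a : ℝ
  b : ℝ
  a_pos : 0 < a
  a_le_b : a ≤ b
  map_zero : toFun 0 = 0
  even : ∀ z, toFun (-z) = toFun z
  continuous : Continuous toFun
  lower : ∀ (s t : ℝ) (z w : E), 0 ≤ s → 0 ≤ t → s + t = 1 →
    a * (s * t) * ‖z - w‖ ^ 2 ≤ s * toFun z + t * toFun w - toFun (s • z + t • w)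
  upper : ∀ (s t : ℝ) (z w : E), 0 ≤ s → 0 ≤ t → s + t = 1 →
    s * toFun z + t * toFun w - toFun (s • z + t • w) ≤ b * (s * t) * ‖z - w‖ ^ 2

namespace QuadraticPotential

variable {E : Type*} [NormedAddCommGroup E] [NormedSpace ℝ E] (P : QuadraticPotential E)

lemma b_pos : 0 < P.b := P.a_pos.trans_le P.a_le_b

/-- The sublevel set that serves as the closed unit ball of the new norm. -/
def body : Set E := {z | P.toFun z ≤ 1}

/-- The Minkowski functional of `P.body`. -/
def luxNorm (z : E) : ℝ := gauge P.body z

lemma mul_norm_sq_le (z : E) : P.a * ‖z‖ ^ 2 ≤ P.toFun z := by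
  have h := P.lower (1 / 2) (1 / 2) z (-z) (by norm_num) (by norm_num) (by norm_num)
  rw [P.even, smul_neg, add_neg_cancel, P.map_zero, sub_neg_eq_add, ← two_smul ℝ z,
    norm_smul] at h
  norm_num at h
  nlinarith

lemma le_mul_norm_sq (z : E) : P.toFun z ≤ P.b * ‖z‖ ^ 2 := by
  have h := P.upper (1 / 2) (1 / 2) z (-z) (by norm_num) (by norm_num) (by norm_num)
  rw [P.even, smul_neg, add_neg_cancel, P.map_zero, sub_neg_eq_add, ← two_smul ℝ z,
    norm_smul] at h
  norm_num at h
  nlinarith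

lemma map_smul_le (r : ℝ) (hr : 0 ≤ r) (hr1 : r ≤ 1) (z : E) :
    P.toFun (r • z) ≤ r * P.toFun z := by
  have h := P.lower r (1 - r) z 0 hr (by linarith) (by ring)
  rw [P.map_zero, smul_zero, add_zero, mul_zero, add_zero] at h
  have : 0 ≤ P.a * (r * (1 - r)) * ‖z - 0‖ ^ 2 :=
    mul_nonneg (mul_nonneg P.a_pos.le (mul_nonneg hr (by linarith))) (sq_nonneg _)
  linarith

lemma le_map_smul (r : ℝ) (hr : 0 ≤ r) (hr1 : r ≤ 1) (z : E) :
    r * P.toFun z - P.b * (r * (1 - r)) * ‖z‖ ^ 2 ≤ P.toFun (r • z) := by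
  have h := P.upper r (1 - r) z 0 hr (by linarith) (by ring)
  rw [P.map_zero, smul_zero, add_zero, mul_zero, add_zero, sub_zero] at h
  linarith

lemma convex_body : Convex ℝ P.body := by
  intro z hz w hw s t hs ht hst
  have hz' : P.toFun z ≤ 1 := hz
  have hw' : P.toFun w ≤ 1 := hw
  have h := P.lower s t z w hs ht hst
  have h0 : 0 ≤ P.a * (s * t) * ‖z - w‖ ^ 2 :=
    mul_nonneg (mul_nonneg P.a_pos.le (mul_nonneg hs ht)) (sq_nonneg _)
  change P.toFun _ ≤ 1
  nlinarith

lemma isClosed_body : IsClosed P.body := isClosed_le P.continuous continuous_const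

lemma mem_interior_body {z : E} (hz : P.toFun z < 1) : z ∈ interior P.body :=
  interior_maximal (fun _ h => le_of_lt h) (isOpen_lt P.continuous continuous_const) hz

lemma body_mem_nhds : P.body ∈ 𝓝 (0 : E) :=
  mem_interior_iff_mem_nhds.1 (P.mem_interior_body (by rw [P.map_zero]; exact one_pos))

lemma absorbent_body : Absorbent ℝ P.body := absorbent_nhds_zero P.body_mem_nhds

lemma luxNorm_le_one_iff {z : E} : P.luxNorm z ≤ 1 ↔ P.toFun z ≤ 1 := by
  rw [luxNorm, gauge_le_one_iff_mem_closure P.convex_body P.body_mem_nhds,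
    P.isClosed_body.closure_eq]
  rfl

lemma luxNorm_eq_one_iff {z : E} : P.luxNorm z = 1 ↔ P.toFun z = 1 := by
  refine ⟨fun h => ?_, fun h => ?_⟩
  · refine le_antisymm (P.luxNorm_le_one_iff.1 h.le) (not_lt.1 fun hlt => ?_)
    rw [luxNorm, gauge_eq_one_iff_mem_frontier P.convex_body P.body_mem_nhds] at h
    exact h.2 (P.mem_interior_body hlt)
  · refine le_antisymm (P.luxNorm_le_one_iff.2 h.le) (not_lt.1 fun hlt => ?_)
    obtain ⟨r, hr0, hr1, w, hw, rfl⟩ := exists_lt_of_gauge_lt P.absorbent_body hlt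
    have hw' : P.toFun w ≤ 1 := hw
    have h2 := P.map_smul_le r hr0.le hr1.le w
    have h3 : P.toFun (r • w) = 1 := h
    nlinarith

lemma luxNorm_nonneg (z : E) : 0 ≤ P.luxNorm z := gauge_nonneg z

lemma luxNorm_add_le (z w : E) : P.luxNorm (z + w) ≤ P.luxNorm z + P.luxNorm w :=
  gauge_add_le P.convex_body P.absorbent_body z w

lemma luxNorm_neg (z : E) : P.luxNorm (-z) = P.luxNorm z :=
  gauge_neg (fun x hx => by
    change P.toFun (-x) ≤ 1
    rw [P.even]
    exact hx) z

lemma luxNorm_smul_of_nonneg {r : ℝ} (hr : 0 ≤ r) (z : E) :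
    P.luxNorm (r • z) = r * P.luxNorm z := gauge_smul_of_nonneg hr z

lemma luxNorm_smul (r : ℝ) (z : E) : P.luxNorm (r • z) = ‖r‖ * P.luxNorm z := by
  rcases le_total 0 r with hr | hr
  · rw [P.luxNorm_smul_of_nonneg hr, Real.norm_of_nonneg hr]
  · rw [← P.luxNorm_neg, ← neg_smul, P.luxNorm_smul_of_nonneg (neg_nonneg.2 hr),
      Real.norm_of_nonpos hr]

lemma isBounded_body : Bornology.IsBounded P.body := by
  refine (isBounded_iff_forall_norm_le).2 ⟨1 + 1 / P.a, fun z hz => ?_⟩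
  have h := (P.mul_norm_sq_le z).trans hz
  have h1 : ‖z‖ ^ 2 ≤ 1 / P.a := by
    rw [le_div_iff₀ P.a_pos]
    linarith
  nlinarith [sq_nonneg (‖z‖ - 1)]

lemma luxNorm_pos {z : E} (hz : z ≠ 0) : 0 < P.luxNorm z :=
  (gauge_pos P.absorbent_body (NormedSpace.isVonNBounded_of_isBounded ℝ P.isBounded_body)).2 hz

lemma luxNorm_zero : P.luxNorm 0 = 0 := gauge_zero

lemma luxNorm_inv_smul {z : E} (hz : 0 < P.luxNorm z) :
    P.luxNorm ((P.luxNorm z)⁻¹ • z) = 1 := by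
  rw [P.luxNorm_smul_of_nonneg (inv_nonneg.2 hz.le), inv_mul_cancel₀ hz.ne']

lemma sq_luxNorm_bounds (z : E) :
    P.a * ‖z‖ ^ 2 ≤ P.luxNorm z ^ 2 ∧ P.luxNorm z ^ 2 ≤ P.b * ‖z‖ ^ 2 := by
  rcases eq_or_ne z 0 with rfl | hz
  · simp [P.luxNorm_zero]
  have hN := P.luxNorm_pos hz
  set N := P.luxNorm z
  have hu : P.toFun (N⁻¹ • z) = 1 := P.luxNorm_eq_one_iff.1 (P.luxNorm_inv_smul hN)
  have h1 := P.mul_norm_sq_le (N⁻¹ • z)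
  have h2 := P.le_mul_norm_sq (N⁻¹ • z)
  rw [hu, norm_smul, norm_inv, Real.norm_of_nonneg hN.le, mul_pow, inv_pow] at h1 h2
  have hN2 : 0 < N ^ 2 := by positivity
  constructor
  · calc P.a * ‖z‖ ^ 2 = P.a * ((N ^ 2)⁻¹ * ‖z‖ ^ 2) * N ^ 2 := by field_simp
      _ ≤ 1 * N ^ 2 := by gcongr
      _ = N ^ 2 := one_mul _
  · calc N ^ 2 = 1 * N ^ 2 := (one_mul _).symm
      _ ≤ P.b * ((N ^ 2)⁻¹ * ‖z‖ ^ 2) * N ^ 2 := by gcongr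
      _ = P.b * ‖z‖ ^ 2 := by field_simp

lemma luxNorm_uniformConvex {ε : ℝ} (hε : 0 < ε) : ∃ δ, 0 < δ ∧ ∀ x, P.luxNorm x = 1 →
    ∀ y, P.luxNorm y = 1 → ε ≤ P.luxNorm (x - y) → P.luxNorm (x + y) ≤ 2 - δ := by
  have ha := P.a_pos
  have hb := P.b_pos
  refine ⟨2 * (P.a * (ε ^ 2 / P.b) / 4) / (1 + P.b / P.a), by positivity,
    fun x hx y hy hxy => ?_⟩
  set z : E := (1 / 2 : ℝ) • x + (1 / 2 : ℝ) • y with hz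
  have hzxy : x + y = (2 : ℝ) • z := by
    rw [hz, ← smul_add, smul_smul]; norm_num
  have h1 := P.lower (1 / 2) (1 / 2) x y (by norm_num) (by norm_num) (by norm_num)
  rw [P.luxNorm_eq_one_iff.1 hx, P.luxNorm_eq_one_iff.1 hy, ← hz] at h1
  have h2 : ε ^ 2 / P.b ≤ ‖x - y‖ ^ 2 := by
    rw [div_le_iff₀ hb]
    nlinarith [(P.sq_luxNorm_bounds (x - y)).2]
  have h3 : P.toFun z ≤ 1 - P.a * (ε ^ 2 / P.b) / 4 := by nlinarith
  set r := P.luxNorm z with hr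
  have hr1 : r ≤ 1 := by
    refine P.luxNorm_le_one_iff.2 (h3.trans ?_)
    have : 0 ≤ P.a * (ε ^ 2 / P.b) / 4 := by positivity
    linarith
  have h4 : 1 - (1 + P.b / P.a) * (1 - r) ≤ P.toFun z := by
    rcases eq_or_ne z 0 with h0 | h0
    · have hr0 : r = 0 := by rw [hr, h0, P.luxNorm_zero]
      have : 0 < P.b / P.a := by positivity
      rw [hr0, h0, P.map_zero]
      linarith
    · have hrp : 0 < r := P.luxNorm_pos h0
      have hu1 := P.luxNorm_inv_smul hrp
      have h5 := P.le_map_smul r hrp.le hr1 (r⁻¹ • z)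
      rw [P.luxNorm_eq_one_iff.1 hu1, smul_smul, mul_inv_cancel₀ hrp.ne', one_smul] at h5
      have h6 := (P.sq_luxNorm_bounds (r⁻¹ • z)).1
      rw [hu1] at h6
      have h7 : P.b * ‖r⁻¹ • z‖ ^ 2 ≤ P.b / P.a := by
        rw [le_div_iff₀ ha]
        nlinarith
      have h8 : P.b * (r * (1 - r)) * ‖r⁻¹ • z‖ ^ 2 ≤ P.b / P.a * (1 - r) := by
        have h9 : r * (1 - r) ≤ 1 - r := by nlinarith
        calc P.b * (r * (1 - r)) * ‖r⁻¹ • z‖ ^ 2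
            = (P.b * ‖r⁻¹ • z‖ ^ 2) * (r * (1 - r)) := by ring
          _ ≤ P.b / P.a * (1 - r) := by
            gcongr
      linarith
  rw [hzxy, P.luxNorm_smul_of_nonneg (by norm_num)]
  have h5 : P.a * (ε ^ 2 / P.b) / 4 / (1 + P.b / P.a) ≤ 1 - r := by
    rw [div_le_iff₀ (by positivity)]
    linarith
  rw [mul_div_assoc]
  linarith

lemma luxNorm_add_luxNorm_sub_le {t : ℝ} (ht2 : t ≤ 1 / 2) {x y : E}
    (hx : P.luxNorm x = 1) (hy : P.luxNorm y ≤ t) :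
    P.luxNorm (x + y) + P.luxNorm (x - y) ≤ 2 + 16 * (P.b / P.a) * t ^ 2 := by
  have ha := P.a_pos
  have hb := P.b_pos
  have hP1 := P.luxNorm_add_le x y
  have hP2 := P.luxNorm_add_le x (-y)
  have hP3 := P.luxNorm_add_le (x + y) (-y)
  have hP4 := P.luxNorm_add_le (x - y) y
  have hP5 := P.luxNorm_add_le (x + y) (x - y)
  rw [P.luxNorm_neg, ← sub_eq_add_neg] at hP2
  rw [P.luxNorm_neg, add_neg_cancel_right] at hP3
  rw [sub_add_cancel] at hP4
  have e2 : x + y + (x - y) = (2 : ℝ) • x := by rw [two_smul]; abel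
  rw [e2, P.luxNorm_smul_of_nonneg (by norm_num)] at hP5
  rw [hx] at hP1 hP2 hP3 hP4 hP5
  set α := P.luxNorm (x + y) with hα
  set β := P.luxNorm (x - y) with hβ
  have hα0 : 0 < α := by linarith
  have hβ0 : 0 < β := by linarith
  set s := (α + β) / 2 with hs
  have hs1 : 1 ≤ s := by rw [hs]; linarith
  have hs2 : s ≤ 2 := by rw [hs]; linarith
  have hs0 : 0 < s := by linarith
  have hu : P.luxNorm (α⁻¹ • (x + y)) = 1 := P.luxNorm_inv_smul hα0
  have hv : P.luxNorm (β⁻¹ • (x - y)) = 1 := P.luxNorm_inv_smul hβ0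
  set u := α⁻¹ • (x + y) with hudef
  set v := β⁻¹ • (x - y) with hvdef
  have hxy : x + y = α • u := by rw [hudef, smul_smul, mul_inv_cancel₀ hα0.ne', one_smul]
  have hxy' : x - y = β • v := by rw [hvdef, smul_smul, mul_inv_cancel₀ hβ0.ne', one_smul]
  have hl : (α / (α + β)) • u + (β / (α + β)) • v = s⁻¹ • x := by
    rw [hudef, hvdef, smul_smul, smul_smul]
    have c1 : α / (α + β) * α⁻¹ = (α + β)⁻¹ := by field_simp
    have c2 : β / (α + β) * β⁻¹ = (α + β)⁻¹ := by field_simp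
    have c3 : s⁻¹ = (α + β)⁻¹ * 2 := by rw [hs]; field_simp
    rw [c1, c2, c3, ← smul_add, e2, smul_smul]
  have h1 := P.upper (α / (α + β)) (β / (α + β)) u v (by positivity) (by positivity)
    (by field_simp)
  rw [P.luxNorm_eq_one_iff.1 hu, P.luxNorm_eq_one_iff.1 hv, hl] at h1
  have h2 := P.map_smul_le s⁻¹ (inv_nonneg.2 hs0.le) (inv_le_one_of_one_le₀ hs1) x
  rw [P.luxNorm_eq_one_iff.1 hx] at h2
  have h3 : α / (α + β) + β / (α + β) = 1 := by field_simp
  have h4 : α / (α + β) * (β / (α + β)) ≤ 1 / 4 := by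
    nlinarith [sq_nonneg (α / (α + β) - β / (α + β))]
  have huv : P.luxNorm (u - v) ≤ 4 * t := by
    have k : u - v = (1 - α) • u + ((2 : ℝ) • y + (-(1 - β)) • v) := by
      rw [sub_smul, neg_smul, sub_smul, one_smul, one_smul, ← hxy, ← hxy', two_smul]
      abel
    rw [k]
    refine (P.luxNorm_add_le _ _).trans ?_
    have k2 := P.luxNorm_add_le ((2 : ℝ) • y) ((-(1 - β)) • v)
    rw [P.luxNorm_smul_of_nonneg (by norm_num : (0 : ℝ) ≤ 2), P.luxNorm_smul, hv, norm_neg,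
      Real.norm_eq_abs] at k2
    rw [P.luxNorm_smul, hu, Real.norm_eq_abs]
    have k3 : |1 - α| ≤ t := abs_le.2 ⟨by linarith, by linarith⟩
    have k4 : |1 - β| ≤ t := abs_le.2 ⟨by linarith, by linarith⟩
    linarith
  have h5 : ‖u - v‖ ^ 2 ≤ 16 * t ^ 2 / P.a := by
    rw [le_div_iff₀ ha]
    have := (P.sq_luxNorm_bounds (u - v)).1
    nlinarith [P.luxNorm_nonneg (u - v)]
  have h6 : 1 - s⁻¹ ≤ 4 * (P.b / P.a) * t ^ 2 := by
    calc 1 - s⁻¹ ≤ P.b * (α / (α + β) * (β / (α + β))) * ‖u - v‖ ^ 2 := by linarith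
      _ ≤ P.b * (1 / 4) * (16 * t ^ 2 / P.a) := by gcongr
      _ = 4 * (P.b / P.a) * t ^ 2 := by ring
  have h7 : s - 1 ≤ 2 * (4 * (P.b / P.a) * t ^ 2) := by
    calc s - 1 = s * (1 - s⁻¹) := by field_simp
      _ ≤ s * (4 * (P.b / P.a) * t ^ 2) := by gcongr
      _ ≤ 2 * (4 * (P.b / P.a) * t ^ 2) := by gcongr
  rw [hs] at h7
  linarith

/-- The space `E` renormed by the Minkowski functional of `P.body`. -/
def Renormed (_ : QuadraticPotential E) : Type _ := E

instance : AddCommGroup P.Renormed := inferInstanceAs (AddCommGroup E)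

instance : Module ℝ P.Renormed := inferInstanceAs (Module ℝ E)

instance : Norm P.Renormed := ⟨P.luxNorm⟩

lemma renormedCore : NormedSpace.Core ℝ P.Renormed where
  norm_nonneg := P.luxNorm_nonneg
  norm_smul := P.luxNorm_smul
  norm_triangle := P.luxNorm_add_le
  norm_eq_zero_iff _ :=
    ⟨fun h => by_contra fun hx => (P.luxNorm_pos hx).ne' h, fun h => h ▸ P.luxNorm_zero⟩

instance : NormedAddCommGroup P.Renormed := NormedAddCommGroup.ofCore P.renormedCore

instance : NormedSpace ℝ P.Renormed := NormedSpace.ofCore P.renormedCore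

/-- The identity map from `E` to the renormed space. -/
def toRenormed : E ≃ₗ[ℝ] P.Renormed := LinearEquiv.refl ℝ E

instance [FiniteDimensional ℝ E] : FiniteDimensional ℝ P.Renormed :=
  P.toRenormed.finiteDimensional

instance : UniformConvexSpace P.Renormed where
  uniform_convex _ hε :=
    let ⟨δ, hδ, h⟩ := P.luxNorm_uniformConvex hε
    ⟨δ, hδ, fun x hx y hy => h x hx y hy⟩

lemma uniformlySmooth : UniformlySmooth P.Renormed := by
  have hlim : Tendsto (fun t : ℝ => 8 * (P.b / P.a) * t) (𝓝[>] 0) (𝓝 0) := by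
    have : Tendsto (fun t : ℝ => 8 * (P.b / P.a) * t) (𝓝 0) (𝓝 (8 * (P.b / P.a) * 0)) :=
      tendsto_id.const_mul _
    rw [mul_zero] at this
    exact this.mono_left nhdsWithin_le_nhds
  have ha := P.a_pos
  have hb := P.b_pos
  have hmem : Set.Ioc (0 : ℝ) (1 / 2) ∈ 𝓝[>] (0 : ℝ) := Ioc_mem_nhdsGT (by norm_num)
  refine tendsto_of_tendsto_of_tendsto_of_le_of_le' tendsto_const_nhds hlim ?_ ?_
  · filter_upwards [hmem] with t ht
    refine div_nonneg (Real.sSup_nonneg ?_) ht.1.le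
    rintro _ ⟨x, y, hx, -, rfl⟩
    have h := norm_add_le (x + y) (x - y)
    have e : x + y + (x - y) = (2 : ℝ) • x := by rw [two_smul]; abel
    rw [e, norm_smul, hx] at h
    norm_num at h
    linarith
  · filter_upwards [hmem] with t ht
    rw [div_le_iff₀ ht.1]
    refine Real.sSup_le ?_ (by have := ht.1; positivity)
    rintro _ ⟨x, y, hx, hy, rfl⟩
    have : ‖x + y‖ + ‖x - y‖ ≤ 2 + 16 * (P.b / P.a) * t ^ 2 :=
      P.luxNorm_add_luxNorm_sub_le ht.2 hx hy
    nlinarith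

end QuadraticPotential

/-- The log-periodic perturbation `y² (1 + σ (3 sin log|y| + cos log|y|) / 5)` of the square. For
`σ = ± 1` it is convex and its second derivative `2 + 2σ cos log|y|` vanishes on a sequence
tending to `0`. -/
def logWave (σ y : ℝ) : ℝ :=
  y ^ 2 * (1 + σ * (3 * Real.sin (Real.log y) + Real.cos (Real.log y)) / 5)

/-- The derivative of `logWave σ`. -/
def logWaveDeriv (σ y : ℝ) : ℝ :=
  y * (2 + σ * (Real.sin (Real.log y) + Real.cos (Real.log y)))

lemma hasDerivAt_logWave (σ y : ℝ) : HasDerivAt (logWave σ) (logWaveDeriv σ y) y := by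
  rcases eq_or_ne y 0 with rfl | hy
  · have h0 : logWaveDeriv σ 0 = 0 := by simp [logWaveDeriv]
    rw [h0, hasDerivAt_iff_isLittleO]
    have hO : (fun x : ℝ => logWave σ x) =O[𝓝 0] fun x => x ^ 2 := by
      refine Asymptotics.IsBigO.of_bound (1 + |σ|) (Eventually.of_forall fun x => ?_)
      rw [logWave, norm_mul, mul_comm]
      gcongr
      rw [Real.norm_eq_abs]
      set L := Real.log x
      have h1 : |(3 * Real.sin L + Real.cos L) / 5| ≤ 1 := by
        rw [abs_le]
        constructor <;>
          linarith [Real.sin_le_one L, Real.cos_le_one L, Real.neg_one_le_sin L,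
            Real.neg_one_le_cos L]
      calc |1 + σ * (3 * Real.sin L + Real.cos L) / 5|
          ≤ |1| + |σ * (3 * Real.sin L + Real.cos L) / 5| := abs_add_le _ _
        _ = 1 + |σ| * |(3 * Real.sin L + Real.cos L) / 5| := by
          rw [abs_one, mul_div_assoc, abs_mul]
        _ ≤ 1 + |σ| := by
          gcongr
          exact mul_le_of_le_one_right (abs_nonneg _) h1
    have ho : (fun x : ℝ => x ^ 2) =o[𝓝 0] fun x => x := by
      simpa using Asymptotics.isLittleO_pow_id (𝕜 := ℝ) (n := 2) (by norm_num)
    simpa [logWave] using hO.trans_isLittleO ho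
  · have hL := Real.hasDerivAt_log hy
    have h := (hasDerivAt_pow 2 y).mul ((((hL.sin.const_mul 3).add hL.cos).const_mul
      (σ / 5)).const_add 1)
    refine (h.congr_deriv ?_).congr_of_eventuallyEq (Eventually.of_forall fun x => ?_)
    · rw [logWaveDeriv]
      simp only [Pi.add_apply]
      field_simp
      ring
    · simp only [logWave, Pi.add_apply, Pi.mul_apply]
      ring

lemma hasDerivAt_logWaveDeriv (σ : ℝ) {y : ℝ} (hy : y ≠ 0) :
    HasDerivAt (logWaveDeriv σ) (2 + 2 * σ * Real.cos (Real.log y)) y := by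
  have hL := Real.hasDerivAt_log hy
  have h := (hasDerivAt_id y).mul (((hL.sin.add hL.cos).const_mul σ).const_add 2)
  refine (h.congr_deriv ?_).congr_of_eventuallyEq (Eventually.of_forall fun x => ?_)
  · simp only [id, Pi.add_apply]
    field_simp
    ring
  · simp only [logWaveDeriv, id, Pi.add_apply, Pi.mul_apply]

lemma abs_logWaveDeriv_le {σ : ℝ} (hσ : |σ| ≤ 1) (y : ℝ) : |logWaveDeriv σ y| ≤ 4 * |y| := by
  set L := Real.log y with hL
  rw [logWaveDeriv, abs_mul, mul_comm, ← hL]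
  gcongr
  have h1 : |Real.sin L + Real.cos L| ≤ 2 :=
    (abs_add_le _ _).trans (by linarith [Real.abs_sin_le_one L, Real.abs_cos_le_one L])
  calc |2 + σ * (Real.sin L + Real.cos L)| ≤ |2| + |σ * (Real.sin L + Real.cos L)| :=
        abs_add_le _ _
    _ ≤ 2 + 1 * 2 := by
      rw [abs_mul, abs_two]
      gcongr
    _ = 4 := by norm_num

lemma monotone_logWaveDeriv {σ : ℝ} (hσ : |σ| ≤ 1) : Monotone (logWaveDeriv σ) := by
  refine monotone_of_odd_of_monotoneOn_nonneg (fun x => ?_) ?_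
  · simp only [logWaveDeriv, Real.log_neg_eq_log]
    ring
  · refine monotoneOn_of_deriv_nonneg (convex_Ici 0) (fun x _ => ?_) ?_ ?_
    · refine ContinuousAt.continuousWithinAt ?_
      rcases eq_or_ne x 0 with rfl | hx
      · have h0 : logWaveDeriv σ 0 = 0 := by simp [logWaveDeriv]
        rw [ContinuousAt, h0]
        refine squeeze_zero_norm (fun y => abs_logWaveDeriv_le hσ y) ?_
        have : Tendsto (fun y : ℝ => 4 * |y|) (𝓝 0) (𝓝 (4 * |0|)) :=
          (continuous_const.mul continuous_abs).tendsto 0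
        simpa using this
      · exact (hasDerivAt_logWaveDeriv σ hx).continuousAt
    · intro x hx
      rw [interior_Ici] at hx
      exact (hasDerivAt_logWaveDeriv σ (ne_of_gt hx)).differentiableAt.differentiableWithinAt
    · intro x hx
      rw [interior_Ici] at hx
      rw [(hasDerivAt_logWaveDeriv σ (ne_of_gt hx)).deriv]
      have h1 : |σ * Real.cos (Real.log x)| ≤ 1 := by
        rw [abs_mul]
        exact mul_le_one₀ hσ (abs_nonneg _) (Real.abs_cos_le_one _)
      linarith [(abs_le.1 h1).1]

lemma convexOn_logWave {σ : ℝ} (hσ : |σ| ≤ 1) : ConvexOn ℝ Set.univ (logWave σ) := by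
  refine Monotone.convexOn_univ_of_deriv
    (fun y => (hasDerivAt_logWave σ y).differentiableAt) ?_
  have : deriv (logWave σ) = logWaveDeriv σ := funext fun y => (hasDerivAt_logWave σ y).deriv
  rw [this]
  exact monotone_logWaveDeriv hσ

lemma logWave_neg (σ y : ℝ) : logWave σ (-y) = logWave σ y := by
  simp [logWave]

lemma logWave_neg_left (σ y : ℝ) : logWave (-σ) y = 2 * y ^ 2 - logWave σ y := by
  simp only [logWave]
  ring

lemma sq_le_logWave_one (y : ℝ) : y ^ 2 / 5 ≤ logWave 1 y := by
  rw [logWave, div_eq_mul_inv]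
  gcongr
  linarith [Real.neg_one_le_sin (Real.log y), Real.neg_one_le_cos (Real.log y)]

/-- The potential `x² + y² / 8 + C logWave 1 y` on the plane. -/
def wavePotential (C : ℝ) (hC : 0 ≤ C) : QuadraticPotential (ℝ × ℝ) where
  toFun z := z.1 ^ 2 + z.2 ^ 2 / 8 + C * logWave 1 z.2
  a := 1 / 8
  b := 2 + 2 * C
  a_pos := by norm_num
  a_le_b := by linarith
  map_zero := by simp [logWave]
  even z := by simp [logWave_neg]
  continuous := by
    have : Continuous (logWave 1) :=
      continuous_iff_continuousAt.2 fun y => (hasDerivAt_logWave 1 y).continuousAt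
    fun_prop
  lower s t z w hs ht hst := by
    have h := (convexOn_logWave (σ := 1) (by simp)).2 (Set.mem_univ z.2) (Set.mem_univ w.2)
      hs ht hst
    simp only [smul_eq_mul] at h
    have hn : ‖z - w‖ ^ 2 ≤ (z.1 - w.1) ^ 2 + (z.2 - w.2) ^ 2 := by
      rw [Prod.norm_def, Real.norm_eq_abs, Real.norm_eq_abs]
      rcases max_choice |(z - w).1| |(z - w).2| with h | h <;> rw [h, sq_abs] <;>
        simp only [Prod.fst_sub, Prod.snd_sub] <;> nlinarith
    have hst0 : 0 ≤ s * t := mul_nonneg hs ht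
    obtain rfl : t = 1 - s := by linarith
    simp only [Prod.fst_add, Prod.smul_fst, Prod.snd_add, Prod.smul_snd, smul_eq_mul]
    have h1 := mul_le_mul_of_nonneg_left h hC
    have h2 := mul_le_mul_of_nonneg_left hn hst0
    have h3 := mul_nonneg hst0 (sq_nonneg (z.1 - w.1))
    linarith
  upper s t z w hs ht hst := by
    have h := (convexOn_logWave (σ := -1) (by simp)).2 (Set.mem_univ z.2) (Set.mem_univ w.2)
      hs ht hst
    simp only [smul_eq_mul, logWave_neg_left] at h
    have hn1 : (z.1 - w.1) ^ 2 ≤ ‖z - w‖ ^ 2 := by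
      rw [← sq_abs (z.1 - w.1)]
      gcongr
      exact norm_fst_le (z - w)
    have hn2 : (z.2 - w.2) ^ 2 ≤ ‖z - w‖ ^ 2 := by
      rw [← sq_abs (z.2 - w.2)]
      gcongr
      exact norm_snd_le (z - w)
    have hst0 : 0 ≤ s * t := mul_nonneg hs ht
    obtain rfl : t = 1 - s := by linarith
    simp only [Prod.fst_add, Prod.smul_fst, Prod.snd_add, Prod.smul_snd, smul_eq_mul]
    have h1 := mul_le_mul_of_nonneg_left h hC
    have h2 := mul_le_mul_of_nonneg_left hn1 hst0
    have h3 := mul_le_mul_of_nonneg_left hn2 hst0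
    have h4 := mul_le_mul_of_nonneg_left h3 hC
    nlinarith

lemma abs_one_add_rpow_add_abs_one_sub_rpow_le {r s : ℝ} (hr : 0 < r) (hs : |s| ≤ 1) :
    |1 + s| ^ r + |1 - s| ^ r ≤ 2 * (1 + r * Real.exp r * s ^ 2) ^ (r / 2) := by
  obtain ⟨hs1, hs2⟩ := abs_le.1 hs
  have h1 : |1 + s| ^ r ≤ Real.exp (r * s) := by
    rw [abs_of_nonneg (by linarith), mul_comm, Real.exp_mul]
    exact Real.rpow_le_rpow (by linarith) (by linarith [Real.add_one_le_exp s]) hr.le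
  have h2 : |1 - s| ^ r ≤ Real.exp (-(r * s)) := by
    rw [abs_of_nonneg (by linarith), mul_comm, ← neg_mul, Real.exp_mul]
    exact Real.rpow_le_rpow (by linarith) (by linarith [Real.add_one_le_exp (-s)]) hr.le
  have h3 := Real.cosh_le_exp_half_sq (r * s)
  rw [Real.cosh_eq] at h3
  have h4 : Real.exp ((r * s) ^ 2 / 2) = Real.exp (r * s ^ 2) ^ (r / 2) := by
    rw [← Real.exp_mul]
    congr 1
    ring
  have hs3 : s ^ 2 ≤ 1 := by nlinarith
  have h5 : Real.exp (r * s ^ 2) ≤ 1 + r * Real.exp r * s ^ 2 := by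
    have e1 := Real.add_one_le_exp (-(r * s ^ 2))
    have e2 : Real.exp (r * s ^ 2) ≤ Real.exp r :=
      Real.exp_le_exp.2 (mul_le_of_le_one_right hr.le hs3)
    have e3 : Real.exp (r * s ^ 2) * Real.exp (-(r * s ^ 2)) = 1 := by
      rw [← Real.exp_add, add_neg_cancel, Real.exp_zero]
    have e4 : Real.exp (r * s ^ 2) * (r * s ^ 2) ≤ Real.exp r * (r * s ^ 2) := by gcongr
    have e5 := mul_le_mul_of_nonneg_left e1 (Real.exp_pos (r * s ^ 2)).le
    linarith
  have h6 : Real.exp (r * s ^ 2) ^ (r / 2) ≤ (1 + r * Real.exp r * s ^ 2) ^ (r / 2) :=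
    Real.rpow_le_rpow (Real.exp_pos _).le h5 (by positivity)
  linarith

lemma abs_add_rpow_add_abs_sub_rpow_le_two {r x y : ℝ} (hr : 0 < r)
    (h : x ^ 2 + (r * Real.exp r + 4) * y ^ 2 ≤ 1) : |x + y| ^ r + |x - y| ^ r ≤ 2 := by
  have hc : 0 < r * Real.exp r := by positivity
  have hcy : 0 ≤ r * Real.exp r * y ^ 2 := by positivity
  rcases le_or_gt |x| |y| with hxy | hxy
  · have hx2 := sq_le_sq.2 hxy
    have h1 : |x + y| ≤ 1 := by
      rw [← sq_le_one_iff_abs_le_one]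
      nlinarith [sq_nonneg (x - y)]
    have h2 : |x - y| ≤ 1 := by
      rw [← sq_le_one_iff_abs_le_one]
      nlinarith [sq_nonneg (x + y)]
    linarith [Real.rpow_le_one (abs_nonneg _) h1 hr.le, Real.rpow_le_one (abs_nonneg _) h2 hr.le]
  · have hx : 0 < |x| := (abs_nonneg y).trans_lt hxy
    have hx0 : x ≠ 0 := abs_pos.1 hx
    have hs : |y / x| ≤ 1 := by
      rw [abs_div, div_le_one hx]
      exact hxy.le
    have h1 := abs_one_add_rpow_add_abs_one_sub_rpow_le hr hs
    have e1 : |x + y| ^ r = |x| ^ r * |1 + y / x| ^ r := by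
      rw [← Real.mul_rpow (abs_nonneg _) (abs_nonneg _), ← abs_mul]
      congr 2
      field_simp
    have e2 : |x - y| ^ r = |x| ^ r * |1 - y / x| ^ r := by
      rw [← Real.mul_rpow (abs_nonneg _) (abs_nonneg _), ← abs_mul]
      congr 2
      field_simp
    have e3 : |x| ^ r = (x ^ 2) ^ (r / 2) := by
      rw [← sq_abs, ← Real.rpow_natCast, ← Real.rpow_mul (abs_nonneg _)]
      congr 1
      push_cast
      ring
    have e4 : |x| ^ r * (1 + r * Real.exp r * (y / x) ^ 2) ^ (r / 2) ≤ 1 := by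
      rw [e3, ← Real.mul_rpow (sq_nonneg _) (by positivity)]
      refine Real.rpow_le_one (by positivity) ?_ (by positivity)
      have : x ^ 2 * (1 + r * Real.exp r * (y / x) ^ 2) = x ^ 2 + r * Real.exp r * y ^ 2 := by
        field_simp
      rw [this]
      nlinarith [sq_nonneg y]
    rw [e1, e2, ← mul_add]
    calc |x| ^ r * (|1 + y / x| ^ r + |1 - y / x| ^ r)
        ≤ |x| ^ r * (2 * (1 + r * Real.exp r * (y / x) ^ 2) ^ (r / 2)) := by gcongr
      _ = 2 * (|x| ^ r * (1 + r * Real.exp r * (y / x) ^ 2) ^ (r / 2)) := by ring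
      _ ≤ 2 := by linarith

lemma not_isLocalMax_of_hasDerivAt_pos {f f' : ℝ → ℝ} {c a : ℝ}
    (hf : ∀ t, HasDerivAt f (f' t) t) (hf' : HasDerivAt f' c a) (hc : 0 < c) :
    ¬ IsLocalMax f a := by
  intro hmax
  have hd : deriv f = f' := funext fun t => (hf t).deriv
  have h0 : deriv f a = 0 := by rw [hd]; exact hmax.hasDerivAt_eq_zero (hf a)
  have hmin : IsLocalMin f a :=
    isLocalMin_of_deriv_deriv_pos (by rw [hd, hf'.deriv]; exact hc) h0 (hf a).continuousAt
  have hconst : f =ᶠ[𝓝 a] fun _ => f a := by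
    filter_upwards [hmax, hmin] with t h1 h2 using le_antisymm h1 h2
  have h1 : deriv f =ᶠ[𝓝 a] fun _ => 0 := by simpa using hconst.deriv
  have h2 := h1.deriv_eq
  rw [hd, hf'.deriv, deriv_const] at h2
  exact hc.ne' h2

lemma hasDerivAt_quadratic (A B D t : ℝ) :
    HasDerivAt (fun t : ℝ => A + B * t - D * t ^ 2) (B - 2 * D * t) t := by
  have h := (((hasDerivAt_id t).const_mul B).const_add A).sub ((hasDerivAt_pow 2 t).const_mul D)
  refine h.congr_deriv ?_
  norm_num
  ring

lemma hasDerivAt_quadratic_rpow {r : ℝ} (hr : 1 ≤ r) (A B D t : ℝ) :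
    HasDerivAt (fun t : ℝ => (A + B * t - D * t ^ 2) ^ r)
      ((B - 2 * D * t) * r * (A + B * t - D * t ^ 2) ^ (r - 1)) t :=
  (hasDerivAt_quadratic A B D t).rpow_const (Or.inr hr)

lemma hasDerivAt_deriv_quadratic_rpow {r A B D : ℝ} (hA : 0 < A) :
    HasDerivAt (fun t : ℝ => (B - 2 * D * t) * r * (A + B * t - D * t ^ 2) ^ (r - 1))
      (r * A ^ (r - 2) * ((r - 1) * B ^ 2 - 2 * D * A)) 0 := by
  have h1 : HasDerivAt (fun t : ℝ => (B - 2 * D * t) * r) (-(2 * D) * r) 0 := by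
    have := (((hasDerivAt_id (0 : ℝ)).const_mul (2 * D)).const_sub B).mul_const r
    simpa using this
  have h2 := (hasDerivAt_quadratic A B D 0).rpow_const (p := r - 1)
    (Or.inl (by simpa using hA.ne'))
  refine (h1.mul h2).congr_deriv ?_
  have e1 : A ^ (r - 1) = A ^ (r - 2) * A := by
    rw [← Real.rpow_add_one hA.ne']
    congr 1
    ring
  have e2 : r - 1 - 1 = r - 2 := by ring
  simp only [mul_zero, sub_zero, add_zero, ne_eq, OfNat.ofNat_ne_zero, not_false_eq_true,
    zero_pow, e1, e2]
  ring

lemma second_order_coeff_pos {r k u x₀ m α β : ℝ} (hr : 2 ≤ r) (hk : 0 < k) (hu : 0 < u)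
    (hu1 : u ≤ 1 / 100) (hx : 9 / 10 ≤ x₀) (hx1 : x₀ ≤ 1) (hm0 : 0 ≤ m) (hm1 : m ≤ 1 / 10)
    (h1 : 9 / 10 * k ≤ α) (h2 : α ≤ 11 / 10 * k) (h3 : |β| ≤ 11 / 10 * k)
    (h4 : 9 / 10 * k ≤ |β|) :
    0 < α * x₀ + β * u ∧ 0 < (r - 1) * (β - α * m) ^ 2 - 2 * (α / 8) * (α * x₀ + β * u) := by
  have hα : 0 < α := by nlinarith
  have hbu : |β * u| ≤ 11 / 10 * k * (1 / 100) := by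
    rw [abs_mul, abs_of_pos hu]
    gcongr
  have hax : α * x₀ ≤ 11 / 10 * k * 1 := by gcongr
  have hax' : 9 / 10 * k * (9 / 10) ≤ α * x₀ := by gcongr
  have ham : |α * m| ≤ 11 / 10 * k * (1 / 10) := by
    rw [abs_of_nonneg (by positivity)]
    gcongr
  obtain ⟨h5, h6⟩ := abs_le.1 hbu
  have h7 : 79 / 100 * k ≤ |β - α * m| := by
    have := abs_sub_abs_le_abs_sub β (α * m)
    linarith
  have h8 : (79 / 100 * k) ^ 2 ≤ (β - α * m) ^ 2 := by
    rw [← sq_abs (β - α * m)]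
    gcongr
  have h9 : α / 8 * (α * x₀ + β * u) ≤ (11 / 10 * k) / 8 * (12 / 10 * k) := by
    gcongr
    · linarith
    · linarith
  refine ⟨by linarith, ?_⟩
  have h10 : (β - α * m) ^ 2 ≤ (r - 1) * (β - α * m) ^ 2 :=
    le_mul_of_one_le_left (sq_nonneg _) (by linarith)
  have h11 : 0 < k ^ 2 := by positivity
  linarith

lemma isLocalMax_wavePotential_comp {C u x₀ m : ℝ} (hC : 0 ≤ C) (hu : u ≠ 0)
    (hx : 9 / 10 ≤ x₀) (hm0 : 0 ≤ m) (hm1 : m ≤ 1 / 10) (hmx : 2 * x₀ * m = u * (1 / 4 + C))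
    (hsin : Real.sin (Real.log u) = 0) (hcos : Real.cos (Real.log u) = -1) :
    IsLocalMax (fun t : ℝ => (wavePotential C hC).toFun
      (x₀ + (-m) * t - (1 / 8) * t ^ 2, u + t)) 0 := by
  let X : ℝ → ℝ := fun t => x₀ + (-m) * t - (1 / 8) * t ^ 2
  have hXd : ∀ t, HasDerivAt X (-m - 2 * (1 / 8) * t) t := hasDerivAt_quadratic x₀ (-m) (1 / 8)
  have hshift : ∀ t : ℝ, HasDerivAt (fun t : ℝ => u + t) 1 t :=
    fun t => (hasDerivAt_id t).const_add u
  have hd : ∀ t, HasDerivAt (fun t => (wavePotential C hC).toFun (X t, u + t))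
      (2 * X t * (-m - 2 * (1 / 8) * t) + (u + t) / 4 + C * logWaveDeriv 1 (u + t)) t := by
    intro t
    have h1 := (hasDerivAt_logWave 1 (u + t)).comp t (hshift t)
    have h := (((hXd t).pow 2).add (((hshift t).pow 2).div_const 8)).add (h1.const_mul C)
    refine h.congr_deriv ?_
    norm_num
    ring
  have hd2 : HasDerivAt (fun t => 2 * X t * (-m - 2 * (1 / 8) * t) + (u + t) / 4 +
      C * logWaveDeriv 1 (u + t)) (2 * m ^ 2 - x₀ / 2 + 1 / 4) 0 := by
    have h0 : HasDerivAt (logWaveDeriv 1) (2 + 2 * 1 * Real.cos (Real.log (u + 0))) (u + 0) :=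
      hasDerivAt_logWaveDeriv 1 (by rw [add_zero]; exact hu)
    have h1 := h0.comp (0 : ℝ) (hshift 0)
    have h2 : HasDerivAt (fun t : ℝ => -m - 2 * (1 / 8) * t) (-(2 * (1 / 8))) 0 := by
      simpa only [id, mul_one] using
        ((hasDerivAt_id (0 : ℝ)).const_mul (2 * (1 / 8) : ℝ)).const_sub (-m)
    have h := ((((hXd 0).const_mul 2).mul h2).add ((hshift 0).div_const 4)).add
      (h1.const_mul C)
    refine h.congr_deriv ?_
    rw [add_zero, hcos]
    simp only [X]
    ring
  have hderiv := funext fun t => (hd t).deriv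
  refine isLocalMax_of_deriv_deriv_neg ?_ ?_ (hd 0).continuousAt
  · rw [hderiv, hd2.deriv]
    nlinarith
  · rw [hderiv]
    simp only [X, logWaveDeriv, add_zero, hsin, hcos]
    linarith

/-- Near a point of the unit sphere of the wave potential where `logWave` is flat, no operator
close to `(x, y) ↦ k (x + y, x - y)` can attain its norm. -/
lemma wavePotential_no_norming {r k C u x₀ α β γ δ : ℝ} (hr : 2 ≤ r) (hk : 0 < k) (hC : 0 ≤ C)
    (hα : |α - k| ≤ k / 10) (hβ : |β - k| ≤ k / 10) (hγ : |γ - k| ≤ k / 10)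
    (hδ : |δ + k| ≤ k / 10) (hu : 0 < u) (hu1 : u ≤ 1 / 100) (hx : 9 / 10 ≤ x₀) (hx1 : x₀ ≤ 1)
    (huC : u * (1 / 4 + C) ≤ 18 / 100) (hsin : Real.sin (Real.log u) = 0)
    (hcos : Real.cos (Real.log u) = -1)
    (hG : (wavePotential C hC).toFun (x₀, u) = 1)
    (hS : ∀ x y, (wavePotential C hC).toFun (x, y) ≤ 1 →
      |α * x + β * y| ^ r + |γ * x + δ * y| ^ r ≤ 1)
    (hS1 : |α * x₀ + β * u| ^ r + |γ * x₀ + δ * u| ^ r = 1) : False := by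
  obtain ⟨ha1, ha2⟩ := abs_le.1 hα
  obtain ⟨hb1, hb2⟩ := abs_le.1 hβ
  obtain ⟨hc1, hc2⟩ := abs_le.1 hγ
  obtain ⟨hd1, hd2⟩ := abs_le.1 hδ
  set m : ℝ := u * (1 / 4 + C) / (2 * x₀) with hm
  have hx0 : 0 < x₀ := by linarith
  have hm0 : 0 ≤ m := by positivity
  have hm1 : m ≤ 1 / 10 := by
    rw [hm, div_le_iff₀ (by positivity)]
    linarith
  have hmx : 2 * x₀ * m = u * (1 / 4 + C) := by
    rw [hm]
    field_simp
  have hmaxG := isLocalMax_wavePotential_comp hC hu.ne' hx hm0 hm1 hmx hsin hcos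
  have hα0 : 0 < α := by linarith
  have hγ0 : 0 < γ := by linarith
  obtain ⟨hA1, hD1⟩ := second_order_coeff_pos hr hk hu hu1 hx hx1 hm0 hm1 (α := α) (β := β) (by linarith) (by linarith)
    (abs_le.2 ⟨by linarith, by linarith⟩) (le_abs.2 (Or.inl (by linarith)))
  obtain ⟨hA2, hD2⟩ := second_order_coeff_pos hr hk hu hu1 hx hx1 hm0 hm1 (α := γ) (β := δ) (by linarith) (by linarith)
    (abs_le.2 ⟨by linarith, by linarith⟩) (le_abs.2 (Or.inr (by linarith)))
  have hdf := fun t => (hasDerivAt_quadratic_rpow (r := r) (by linarith) (α * x₀ + β * u)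
    (β - α * m) (α / 8) t).add (hasDerivAt_quadratic_rpow (r := r) (by linarith)
    (γ * x₀ + δ * u) (δ - γ * m) (γ / 8) t)
  have hdf2 := (hasDerivAt_deriv_quadratic_rpow (r := r) (B := β - α * m) (D := α / 8) hA1).add
    (hasDerivAt_deriv_quadratic_rpow (r := r) (B := δ - γ * m) (D := γ / 8) hA2)
  have hr0 : 0 < r := by linarith
  refine not_isLocalMax_of_hasDerivAt_pos hdf hdf2 (by positivity) ?_
  filter_upwards [hmaxG] with t ht
  have hX0 : x₀ + -m * 0 - 1 / 8 * 0 ^ 2 = x₀ := by ring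
  rw [hX0, add_zero, hG] at ht
  have h1 := hS _ _ ht
  have e1 : α * (x₀ + -m * t - 1 / 8 * t ^ 2) + β * (u + t) =
      α * x₀ + β * u + (β - α * m) * t - α / 8 * t ^ 2 := by ring
  have e2 : γ * (x₀ + -m * t - 1 / 8 * t ^ 2) + δ * (u + t) =
      γ * x₀ + δ * u + (δ - γ * m) * t - γ / 8 * t ^ 2 := by ring
  rw [e1, e2] at h1
  rw [abs_of_pos hA1, abs_of_pos hA2] at hS1
  have h2 := (le_abs_self _).trans (Real.abs_rpow_le_abs_rpow
    (α * x₀ + β * u + (β - α * m) * t - α / 8 * t ^ 2) r)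
  have h3 := (le_abs_self _).trans (Real.abs_rpow_le_abs_rpow
    (γ * x₀ + δ * u + (δ - γ * m) * t - γ / 8 * t ^ 2) r)
  simp only [Pi.add_apply, mul_zero, add_zero, ne_eq, OfNat.ofNat_ne_zero, not_false_eq_true,
    zero_pow, sub_zero]
  linarith

lemma PiLp.norm_rpow_fin_two {p : ℝ≥0∞} (hp : 0 < p.toReal) (f : PiLp p fun _ : Fin 2 => ℝ) :
    ‖f‖ ^ p.toReal = |f 0| ^ p.toReal + |f 1| ^ p.toReal := by
  rw [PiLp.norm_eq_sum hp, ← Real.rpow_mul (by positivity), one_div, inv_mul_cancel₀ hp.ne',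
    Real.rpow_one, Fin.sum_univ_two, Real.norm_eq_abs, Real.norm_eq_abs]

/-- The linear map `(x, y) ↦ k (x + y, x - y)`. -/
def signMap (p : ℝ≥0∞) (k : ℝ) : ℝ × ℝ →ₗ[ℝ] PiLp p fun _ : Fin 2 => ℝ where
  toFun z := WithLp.toLp p ![k * (z.1 + z.2), k * (z.1 - z.2)]
  map_add' z w := by
    ext i
    fin_cases i <;> simp <;> ring
  map_smul' c z := by
    ext i
    fin_cases i <;> simp <;> ring

lemma norm_signMap_rpow {p : ℝ≥0∞} (hp : 0 < p.toReal) {k : ℝ} (hk : 0 ≤ k) (z : ℝ × ℝ) :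
    ‖signMap p k z‖ ^ p.toReal =
      k ^ p.toReal * (|z.1 + z.2| ^ p.toReal + |z.1 - z.2| ^ p.toReal) := by
  rw [PiLp.norm_rpow_fin_two hp]
  change |k * (z.1 + z.2)| ^ p.toReal + |k * (z.1 - z.2)| ^ p.toReal = _
  rw [abs_mul, abs_mul, abs_of_nonneg hk, Real.mul_rpow hk (abs_nonneg _),
    Real.mul_rpow hk (abs_nonneg _), mul_add]

lemma rpow_le_one_iff_of_nonneg {r a : ℝ} (hr : 0 < r) (ha : 0 ≤ a) : a ^ r ≤ 1 ↔ a ≤ 1 := by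
  rw [← Real.rpow_le_rpow_iff ha zero_le_one hr, Real.one_rpow]

/-- There are points of the unit sphere of the wave potential, arbitrarily close to `(1, 0)`, at
which `logWave 1` is flat. -/
lemma exists_flat_point {C : ℝ} (hC : 0 ≤ C) {V : Set (ℝ × ℝ)} (hV : V ∈ 𝓝 ((1, 0) : ℝ × ℝ)) :
    ∃ x₀ u : ℝ, (x₀, u) ∈ V ∧ 0 < u ∧ u ≤ 1 / 100 ∧ 9 / 10 ≤ x₀ ∧ x₀ ≤ 1 ∧
      u * (1 / 4 + C) ≤ 18 / 100 ∧ Real.sin (Real.log u) = 0 ∧ Real.cos (Real.log u) = -1 ∧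
      (wavePotential C hC).toFun (x₀, u) = 1 := by
  let φ : ℝ → ℝ := fun y => y ^ 2 / 8 + C * logWave 1 y
  have hφ : Continuous φ := by
    have : Continuous (logWave 1) :=
      continuous_iff_continuousAt.2 fun y => (hasDerivAt_logWave 1 y).continuousAt
    fun_prop
  have hφ0 : φ 0 = 0 := by simp [φ, logWave]
  have hφnn : ∀ y, 0 ≤ φ y := fun y => by
    have := (by positivity : (0 : ℝ) ≤ y ^ 2 / 5).trans (sq_le_logWave_one y)
    positivity
  let x : ℝ → ℝ := fun y => √(1 - φ y)
  have hx : Continuous x := by fun_prop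
  have hx0 : x 0 = 1 := by simp [x, hφ0]
  let U : ℕ → ℝ := fun n => Real.exp (Real.pi - n * (2 * Real.pi))
  have hU : Tendsto U atTop (𝓝 0) := by
    refine Real.tendsto_exp_atBot.comp (tendsto_atBot_add_const_left _ _ ?_)
    exact tendsto_neg_atTop_atBot.comp
      (tendsto_natCast_atTop_atTop.atTop_mul_const (by positivity))
  have e1 : ∀ᶠ y in 𝓝 (0 : ℝ), (x y, y) ∈ V := by
    have : Continuous fun y => (x y, y) := by fun_prop
    exact this.continuousAt.eventually_mem (by simpa [hx0] using hV)
  have e2 : ∀ᶠ y in 𝓝 (0 : ℝ), y ≤ 1 / 100 :=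
    eventually_le_nhds (by norm_num)
  have e3 : ∀ᶠ y in 𝓝 (0 : ℝ), 9 / 10 ≤ x y :=
    hx.continuousAt.eventually (eventually_ge_nhds (by rw [hx0]; norm_num))
  have e4 : ∀ᶠ y in 𝓝 (0 : ℝ), y * (1 / 4 + C) ≤ 18 / 100 := by
    have : Continuous fun y : ℝ => y * (1 / 4 + C) := by fun_prop
    exact this.continuousAt.eventually (eventually_le_nhds (by norm_num))
  obtain ⟨n, h1, h2, h3, h4⟩ := (hU.eventually (e1.and (e2.and (e3.and e4)))).exists
  refine ⟨x (U n), U n, h1, Real.exp_pos _, h2, h3, ?_, h4, ?_, ?_, ?_⟩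
  · exact Real.sqrt_le_one.2 (by linarith [hφnn (U n)])
  · simp only [U, Real.log_exp, Real.sin_sub_nat_mul_two_pi, Real.sin_pi]
  · simp only [U, Real.log_exp, Real.cos_sub_nat_mul_two_pi, Real.cos_pi]
  · have h5 : 0 ≤ 1 - φ (U n) := by
      by_contra hneg
      have : x (U n) = 0 := Real.sqrt_eq_zero_of_nonpos (not_le.1 hneg).le
      linarith
    change x (U n) ^ 2 + U n ^ 2 / 8 + C * logWave 1 (U n) = 1
    rw [Real.sq_sqrt h5]
    simp only [φ]
    ring

/-- For every `p ∈ [2, ∞)` there is a uniformly convex and uniformly smooth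
Banach space `X̃_p` such that the pair `(X̃_p, ℓ_p²)` fails the pointwise BPB property. -/
theorem exists_failure_for_lp2 (p : ℝ≥0∞) [Fact (1 ≤ p)] (hp : 2 ≤ p) (hp' : p ≠ ∞) :
    ∃ (X : Type) (_ : NormedAddCommGroup X) (_ : NormedSpace ℝ X) (_ : CompleteSpace X),
      UniformConvexSpace X ∧ UniformlySmooth X ∧
        ¬ PtwiseBPB ℝ X (PiLp p fun _ : Fin 2 => ℝ) := by
  set r := p.toReal with hrdef
  have hr : 2 ≤ r := by
    have := ENNReal.toReal_mono hp' hp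
    simpa using this
  have hr0 : 0 < r := by linarith
  set C : ℝ := 5 * (r * Real.exp r + 4) with hCdef
  have hC : 0 ≤ C := by positivity
  set P := wavePotential C hC with hP
  refine ⟨P.Renormed, inferInstance, inferInstance, FiniteDimensional.complete ℝ _,
    inferInstance, P.uniformlySmooth, fun hBPB => ?_⟩
  set k : ℝ := (1 / 2) ^ (1 / r) with hk
  have hk0 : 0 < k := by positivity
  have hkr : k ^ r = 1 / 2 := by
    rw [hk, ← Real.rpow_mul (by norm_num), one_div_mul_cancel hr0.ne', Real.rpow_one]
  have hunit : ∀ z, P.toFun z ≤ 1 → ‖signMap p k z‖ ≤ 1 := by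
    intro z hz
    rw [← rpow_le_one_iff_of_nonneg hr0 (norm_nonneg _), norm_signMap_rpow hr0 hk0.le, hkr]
    have hz' : z.1 ^ 2 + z.2 ^ 2 / 8 + C * logWave 1 z.2 ≤ 1 := hz
    have h1 := mul_le_mul_of_nonneg_left (sq_le_logWave_one z.2) hC
    have h2 := abs_add_rpow_add_abs_sub_rpow_le_two (x := z.1) (y := z.2) hr0 (by
      have : C * (z.2 ^ 2 / 5) = (r * Real.exp r + 4) * z.2 ^ 2 := by rw [hCdef]; ring
      nlinarith [sq_nonneg z.2])
    linarith
  have he1 : ‖signMap p k (1, 0)‖ = 1 := by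
    have h := norm_signMap_rpow (p := p) hr0 hk0.le (1, 0)
    rw [← hrdef, hkr] at h
    norm_num at h
    exact (Real.rpow_left_inj (norm_nonneg _) zero_le_one hr0.ne').1
      (by rw [h, Real.one_rpow])
  let T : P.Renormed →L[ℝ] PiLp p fun _ : Fin 2 => ℝ :=
    LinearMap.toContinuousLinearMap (signMap p k ∘ₗ P.toRenormed.symm.toLinearMap)
  have hTapp : ∀ z, T (P.toRenormed z) = signMap p k z := fun z => rfl
  have hn1 : ∀ z, P.toFun z = 1 → ‖P.toRenormed z‖ = 1 := fun z hz => P.luxNorm_eq_one_iff.2 hz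
  have hGe1 : P.toFun (1, 0) = 1 := by
    change (1 : ℝ) ^ 2 + 0 ^ 2 / 8 + C * logWave 1 0 = 1
    simp [logWave]
  have hT : ‖T‖ = 1 := by
    refine le_antisymm (T.opNorm_le_of_unit_norm zero_le_one fun z hz => ?_) ?_
    · exact hunit z (P.luxNorm_le_one_iff.1 hz.le)
    · have h := T.le_opNorm (P.toRenormed (1, 0))
      rwa [hTapp, he1, hn1 _ hGe1, mul_one] at h
  have hb : 1 ≤ P.b := by
    change 1 ≤ 2 + 2 * C
    linarith
  obtain ⟨η, hη, hηT⟩ := hBPB (k / (10 * P.b)) (by positivity)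
  have hV : {z : ℝ × ℝ | 1 - η < ‖signMap p k z‖} ∈ 𝓝 ((1, 0) : ℝ × ℝ) := by
    have hcont : Continuous fun z => ‖signMap p k z‖ :=
      (LinearMap.continuous_of_finiteDimensional (signMap p k)).norm
    exact (isOpen_lt continuous_const hcont).mem_nhds (by
      change 1 - η < ‖signMap p k (1, 0)‖
      rw [he1]
      linarith)
  obtain ⟨x₀, u, hmem, hu, hu1, hx, hx1, huC, hsin, hcos, hG⟩ := exists_flat_point hC hV
  obtain ⟨S, hS, hSx, hST⟩ := hηT T (P.toRenormed (x₀, u)) hT (hn1 _ hG) hmem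
  have hent : ∀ (z : ℝ × ℝ) (i : Fin 2), ‖z‖ = 1 →
      |S (P.toRenormed z) i - signMap p k z i| ≤ k / 10 := by
    intro z i hz
    have h1 := PiLp.norm_apply_le ((S - T) (P.toRenormed z)) i
    have h2 := (S - T).le_opNorm (P.toRenormed z)
    have h3 : ‖P.toRenormed z‖ ≤ P.b := by
      have h4 : P.luxNorm z ^ 2 ≤ P.b * ‖z‖ ^ 2 := (P.sq_luxNorm_bounds z).2
      rw [hz] at h4
      change P.luxNorm z ≤ P.b
      nlinarith [P.luxNorm_nonneg z]
    calc |S (P.toRenormed z) i - signMap p k z i| = ‖((S - T) (P.toRenormed z)) i‖ := rfl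
      _ ≤ ‖S - T‖ * ‖P.toRenormed z‖ := h1.trans h2
      _ ≤ k / (10 * P.b) * P.b := by gcongr
      _ = k / 10 := by
        have : P.b ≠ 0 := by linarith
        field_simp
  have hz1 : ‖((1, 0) : ℝ × ℝ)‖ = 1 := by simp [Prod.norm_def]
  have hz2 : ‖((0, 1) : ℝ × ℝ)‖ = 1 := by simp [Prod.norm_def]
  have hlin : ∀ (x y : ℝ) (i : Fin 2), S (P.toRenormed (x, y)) i =
      S (P.toRenormed (1, 0)) i * x + S (P.toRenormed (0, 1)) i * y := by
    intro x y i
    have : ((x, y) : ℝ × ℝ) = x • (1, 0) + y • (0, 1) := by simp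
    rw [this, map_add, map_add, map_smul, map_smul, map_smul, map_smul]
    simp only [PiLp.add_apply, PiLp.smul_apply, smul_eq_mul]
    ring
  have hnorm : ∀ x y : ℝ, ‖S (P.toRenormed (x, y))‖ ^ r =
      |S (P.toRenormed (1, 0)) 0 * x + S (P.toRenormed (0, 1)) 0 * y| ^ r +
      |S (P.toRenormed (1, 0)) 1 * x + S (P.toRenormed (0, 1)) 1 * y| ^ r := by
    intro x y
    rw [PiLp.norm_rpow_fin_two hr0, ← hlin, ← hlin]
  refine wavePotential_no_norming hr hk0 hC (α := S (P.toRenormed (1, 0)) 0)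
    (β := S (P.toRenormed (0, 1)) 0) (γ := S (P.toRenormed (1, 0)) 1)
    (δ := S (P.toRenormed (0, 1)) 1) ?_ ?_ ?_ ?_ hu hu1 hx hx1 huC hsin hcos hG
    (fun x y hxy => ?_) ?_
  · simpa [signMap] using hent (1, 0) 0 hz1
  · simpa [signMap] using hent (0, 1) 0 hz2
  · simpa [signMap] using hent (1, 0) 1 hz1
  · simpa [signMap] using hent (0, 1) 1 hz2
  · rw [← hnorm, rpow_le_one_iff_of_nonneg hr0 (norm_nonneg _)]
    have h := S.le_opNorm (P.toRenormed (x, y))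
    rw [hS, one_mul] at h
    exact h.trans (P.luxNorm_le_one_iff.2 hxy)
  · rw [← hnorm, hSx, Real.one_rpow]

end
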